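/- Let V be a universal conditional decompressor and let C_V(x) denote C_V(x | empty string). There exists a constant D such that the following holds: for every binary string y of length n with n+1 prime, setting k = C_V(y | enc(n)) + 5 and assuming k < n, at least 9/10 of the k×n matrices A over ZMod 2 satisfy C_V(enc(A)·f) ≥ n·k + k − D, where f = A.mulVec y is viewed as a binary string of length k. -/

import Mathlib

/-- Plain Kolmogorov complexity of `x` under decompressor `V`, in `ℕ∞` (`⊤` if no description). -/
noncomputable def plainC (V : List Bool →. List Bool) (x : List Bool) : ℕ∞ :=
  sInf {m : ℕ∞ | ∃ d : List Bool, x ∈ V d ∧ (d.length : ℕ∞) = m}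

/-- Conditional Kolmogorov complexity of `x` given `y` under conditional decompressor `V`. -/
noncomputable def condC (V : List Bool × List Bool →. List Bool) (x y : List Bool) : ℕ∞ :=
  sInf {m : ℕ∞ | ∃ d : List Bool, x ∈ V (d, y) ∧ (d.length : ℕ∞) = m}

/-- `V` is a universal plain decompressor. -/
def PlainUniversal (V : List Bool →. List Bool) : Prop :=
  Partrec V ∧ ∀ W : List Bool →. List Bool, Partrec W →
    ∃ c : ℕ, ∀ x : List Bool, plainC V x ≤ plainC W x + c

/-- `V` is a universal conditional decompressor. -/
def CondUniversal (V : List Bool × List Bool →. List Bool) : Prop :=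
  Partrec V ∧ ∀ W : List Bool × List Bool →. List Bool, Partrec W →
    ∃ c : ℕ, ∀ x y : List Bool, condC V x y ≤ condC W x y + c

/-- Row-major encoding of a `k × n` binary matrix as a binary string (length `n·k`). -/
def encM {k n : ℕ} (A : Matrix (Fin k) (Fin n) (ZMod 2)) : List Bool :=
  (List.finRange k).flatMap fun i => (List.finRange n).map fun j => decide (A i j = 1)

/-- The vector in `(ZMod 2)^n` associated to a binary string (of length `n`). -/
def vecOf (n : ℕ) (s : List Bool) : Fin n → ZMod 2 :=
  fun i => if s.getD i false then 1 else 0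

/-- The binary string (of length `k`) associated to a vector in `(ZMod 2)^k`. -/
def strOf {k : ℕ} (v : Fin k → ZMod 2) : List Bool :=
  List.ofFn fun i => decide (v i = 1)

/-- The partial recursive code associated to a binary string, via the canonical
computable bijection between `List Bool` and `Nat.Partrec.Code`. -/
def codeOf (x : List Bool) : Nat.Partrec.Code :=
  Denumerable.ofNat Nat.Partrec.Code (Encodable.encode x)

/-- The halting set: strings whose associated program halts on the empty input. -/
def Halts (x : List Bool) : Prop := ((codeOf x).eval 0).Dom



/-- The first values, without repetition, of the partial enumeration `g`. -/
def enumList {σ : Type*} [DecidableEq σ] (g : ℕ → Option σ) : ℕ → List σ :=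
  Nat.rec [] fun s L => (g s).casesOn L fun z => if L.idxOf z < L.length then L else L ++ [z]

theorem primrec_enumList {α σ : Type*} [Primcodable α] [Primcodable σ] [DecidableEq σ]
    {g : α → ℕ → Option σ} (hg : Primrec₂ g) : Primrec₂ fun a s => enumList (g a) s := by
  unfold enumList
  refine Primrec.nat_rec (f := fun _ : α => ([] : List σ)) (g := fun a (p : ℕ × List σ) =>
    Option.casesOn (motive := fun _ => List σ) (g a p.1) p.2 fun z =>
      if p.2.idxOf z < p.2.length then p.2 else p.2 ++ [z]) (Primrec.const []) ?_
  refine Primrec.option_casesOn (hg.comp Primrec.fst (Primrec.fst.comp Primrec.snd))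
    (Primrec.snd.comp Primrec.snd) ?_
  have hL : Primrec fun q : (α × ℕ × List σ) × σ => q.1.2.2 :=
    Primrec.snd.comp (Primrec.snd.comp Primrec.fst)
  exact Primrec.ite
    (Primrec.nat_lt.comp (Primrec.list_idxOf.comp Primrec.snd hL) (Primrec.list_length.comp hL)) hL
    (Primrec.list_concat.comp hL Primrec.snd)

theorem enumList_succ {σ : Type*} [DecidableEq σ] (g : ℕ → Option σ) (s : ℕ) :
    enumList g (s + 1) = (g s).casesOn (enumList g s) fun z =>
      if z ∈ enumList g s then enumList g s else enumList g s ++ [z] := by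
  simp only [← List.idxOf_lt_length_iff]
  rfl

theorem enumList_isPrefix_succ {σ : Type*} [DecidableEq σ] (g : ℕ → Option σ) (s : ℕ) :
    enumList g s <+: enumList g (s + 1) := by
  rw [enumList_succ]
  cases g s with
  | none => exact List.prefix_rfl
  | some z => dsimp only; split_ifs <;> simp

theorem enumList_isPrefix_of_le {σ : Type*} [DecidableEq σ] (g : ℕ → Option σ) {s t : ℕ}
    (h : s ≤ t) :
    enumList g s <+: enumList g t := by
  induction t, h using Nat.le_induction with
  | base => exact List.prefix_rfl
  | succ t _ ih => exact ih.trans (enumList_isPrefix_succ g t)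

theorem nodup_enumList {σ : Type*} [DecidableEq σ] (g : ℕ → Option σ) (s : ℕ) :
    (enumList g s).Nodup := by
  induction s with
  | zero => exact List.nodup_nil
  | succ s ih =>
    rw [enumList_succ]
    cases g s with
    | none => exact ih
    | some z =>
      dsimp only
      split_ifs with h
      · exact ih
      · simpa [List.nodup_append, ih] using fun a ha (e : a = z) => h (e ▸ ha)

theorem exists_of_mem_enumList {σ : Type*} [DecidableEq σ] {g : ℕ → Option σ} {s : ℕ} {z : σ}
    (hz : z ∈ enumList g s) : ∃ t, g t = some z := by
  induction s with
  | zero => exact absurd hz List.not_mem_nil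
  | succ s ih =>
    rw [enumList_succ] at hz
    cases hs : g s with
    | none => rw [hs] at hz; exact ih hz
    | some w =>
      rw [hs] at hz
      dsimp only at hz
      split_ifs at hz with h
      · exact ih hz
      · rcases List.mem_append.1 hz with hz | hz
        · exact ih hz
        · exact ⟨s, by rw [hs, List.mem_singleton.1 hz]⟩

theorem mem_enumList {σ : Type*} [DecidableEq σ] {g : ℕ → Option σ} {s : ℕ} {z : σ}
    (h : g s = some z) : z ∈ enumList g (s + 1) := by
  rw [enumList_succ, h]
  dsimp only
  split_ifs with h' <;> simp [h']

/-- A uniformly enumerable family of sets of size at most `N` is uniformly indexed by the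
numbers below `N`. -/
theorem exists_partrec_index {α σ : Type*} [Primcodable α] [Primcodable σ] [DecidableEq σ]
    {g : α → ℕ → Option σ} (hg : Primrec₂ g) :
    ∃ f : α × ℕ →. σ, Partrec f ∧ ∀ (a : α) (N : ℕ),
      (∀ l : List σ, l.Nodup → (∀ z ∈ l, ∃ s, g a s = some z) → l.length ≤ N) →
      ∀ z s, g a s = some z → ∃ i < N, z ∈ f (a, i) := by
  refine ⟨fun p => Nat.rfindOpt fun s => (enumList (g p.1) s)[p.2]?, ?_, ?_⟩
  · refine Partrec.rfindOpt (Primrec.to_comp ?_)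
    exact Primrec.list_getElem?.comp
      ((primrec_enumList hg).comp (Primrec.fst.comp Primrec.fst) Primrec.snd)
      (Primrec.snd.comp Primrec.fst)
  · intro a N hN z s hs
    obtain ⟨i, hi, rfl⟩ := List.getElem_of_mem (mem_enumList hs)
    refine ⟨i, hi.trans_le (hN _ (nodup_enumList _ _) fun z hz => exists_of_mem_enumList hz), ?_⟩
    rw [Nat.rfindOpt_mono]
    · exact ⟨s + 1, by simp [hi]⟩
    · intro b m n hmn hb
      obtain ⟨r, hr⟩ := enumList_isPrefix_of_le (g a) hmn
      simp only [Option.mem_def] at hb ⊢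
      rw [← hr, List.getElem?_append_left (List.getElem?_eq_some_iff.1 hb).1, hb]


theorem card_matrix_zmod_two (k n : ℕ) :
    Fintype.card (Matrix (Fin k) (Fin n) (ZMod 2)) = 2 ^ (n * k) := by
  rw [Fintype.card_congr Matrix.of.symm]
  simp [pow_mul]

open Finset in
/-- For `v ≠ 0`, a uniformly random matrix kills `v` with probability `2 ^ (-k)`. -/
theorem card_mulVec_eq_zero {k n : ℕ} {v : Fin n → ZMod 2} (hv : v ≠ 0) :
    #{A : Matrix (Fin k) (Fin n) (ZMod 2) | A.mulVec v = 0} * 2 ^ k = 2 ^ (n * k) := by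
  classical
  obtain ⟨j, hj⟩ := Function.ne_iff.1 hv
  have hj1 : v j = 1 := by
    have : ∀ a : ZMod 2, a ≠ 0 → a = 1 := by decide
    exact this _ hj
  let f : Matrix (Fin k) (Fin n) (ZMod 2) →+ (Fin k → ZMod 2) :=
    { toFun := fun A => A.mulVec v
      map_zero' := Matrix.zero_mulVec v
      map_add' := fun A B => Matrix.add_mulVec A B v }
  have hf : Function.Surjective f := by
    intro u
    refine ⟨Matrix.of fun i j' => if j' = j then u i else 0, ?_⟩
    ext i
    simp [f, Matrix.mulVec, dotProduct, hj1]
  have key : ∀ u ∈ (univ : Finset (Fin k → ZMod 2)),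
      #{A : Matrix (Fin k) (Fin n) (ZMod 2) | f A = u} = #{A | f A = 0} := fun u _ =>
    AddMonoidHom.card_fiber_eq_of_mem_range f (hf u) (hf 0)
  have h1 := Finset.card_eq_sum_card_fiberwise (s := univ) (t := univ) (f := f)
    (fun _ _ => Finset.mem_coe.2 (mem_univ _))
  rw [Finset.sum_congr rfl key] at h1
  simp only [sum_const, card_univ, smul_eq_mul] at h1
  have hU : Fintype.card (Fin k → ZMod 2) = 2 ^ k := by simp [ZMod.card]
  rw [card_matrix_zmod_two, hU] at h1
  rw [mul_comm]
  exact h1.symm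

open Finset in
/-- Second-moment bound: few vectors `z` are such that `(A, A z)` hits a small set for many `A`. -/
theorem card_heavy_mul_le {k n D : ℕ} (hD : 8 ≤ D)
    (S : Finset (Matrix (Fin k) (Fin n) (ZMod 2) × (Fin k → ZMod 2)))
    (hS : #S * 2 ^ D ≤ 2 ^ (n * k) * 2 ^ k) (Z : Finset (Fin n → ZMod 2))
    (hZ : ∀ z ∈ Z, 2 ^ (n * k) ≤
      10 * #{A : Matrix (Fin k) (Fin n) (ZMod 2) | (A, A.mulVec z) ∈ S}) :
    #Z * 2 ^ D ≤ 2 ^ (k + 8) := by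
  classical
  let m : Matrix (Fin k) (Fin n) (ZMod 2) × (Fin k → ZMod 2) → ℕ :=
    fun p => #{z ∈ Z | p.1.mulVec z = p.2}
  have hT : ∑ p ∈ S, m p =
      ∑ z ∈ Z, #{A : Matrix (Fin k) (Fin n) (ZMod 2) | (A, A.mulVec z) ∈ S} := by
    have := sum_card_bipartiteAbove_eq_sum_card_bipartiteBelow
      (s := S) (t := Z) (fun p z => p.1.mulVec z = p.2)
    refine this.trans (sum_congr rfl fun z _ => ?_)
    refine card_bij' (fun p _ => p.1) (fun A _ => (A, A.mulVec z)) ?_ ?_ ?_ ?_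
    · rintro ⟨A, u⟩ h
      simp only [mem_bipartiteBelow] at h
      simpa [h.2] using h.1
    · intro A h
      simpa [mem_bipartiteBelow] using h
    · rintro ⟨A, u⟩ h
      simp only [mem_bipartiteBelow] at h
      simp [h.2]
    · simp
  have hQ : (∑ p ∈ S, m p ^ 2) * 2 ^ k ≤ 2 ^ (n * k) * (#Z * 2 ^ k + #Z ^ 2) := by
    have h1 : ∑ p ∈ S, m p ^ 2 ≤ ∑ q ∈ Z ×ˢ Z,
        #{A : Matrix (Fin k) (Fin n) (ZMod 2) | A.mulVec q.1 = A.mulVec q.2} := by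
      have h2 : ∀ p, m p ^ 2 =
          #{q ∈ Z ×ˢ Z | p.1.mulVec q.1 = p.2 ∧ p.1.mulVec q.2 = p.2} := fun p => by
        rw [sq, ← card_product, ← filter_product]
      simp only [h2]
      have h3 := sum_card_bipartiteAbove_eq_sum_card_bipartiteBelow (s := S) (t := Z ×ˢ Z)
        (fun p q => p.1.mulVec q.1 = p.2 ∧ p.1.mulVec q.2 = p.2)
      refine h3.le.trans (sum_le_sum fun q _ => ?_)
      refine card_le_card_of_injOn (fun p => p.1) ?_ ?_
      · rintro ⟨A, u⟩ h
        simp only [mem_coe, mem_bipartiteBelow] at h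
        simp [h.2.1, h.2.2]
      · rintro ⟨A, u⟩ h ⟨A', u'⟩ h' e
        simp only [mem_coe, mem_bipartiteBelow] at h h' e
        subst e
        rw [← h.2.1, ← h'.2.1]
    have h4 : ∀ q ∈ Z ×ˢ Z,
        #{A : Matrix (Fin k) (Fin n) (ZMod 2) | A.mulVec q.1 = A.mulVec q.2} * 2 ^ k ≤
          2 ^ (n * k) * ((if q.1 = q.2 then 2 ^ k else 0) + 1) := by
      intro q _
      by_cases h : q.1 = q.2
      · simp only [h, filter_true, card_univ, if_true, card_matrix_zmod_two]
        gcongr; omega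
      · have := card_mulVec_eq_zero (k := k) (sub_ne_zero.2 h)
        simp only [Matrix.mulVec_sub, sub_eq_zero] at this
        simp [h, this]
    calc (∑ p ∈ S, m p ^ 2) * 2 ^ k ≤ _ := Nat.mul_le_mul_right _ h1
      _ ≤ ∑ q ∈ Z ×ˢ Z, 2 ^ (n * k) * ((if q.1 = q.2 then 2 ^ k else 0) + 1) := by
        rw [sum_mul]; exact sum_le_sum h4
      _ = _ := by
        rw [← mul_sum, sum_add_distrib, sum_product]
        simp [sq]
  have hcs : (∑ p ∈ S, m p) ^ 2 ≤ #S * ∑ p ∈ S, m p ^ 2 := sq_sum_le_card_mul_sum_sq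
  have hlow : #Z * 2 ^ (n * k) ≤ 10 * ∑ p ∈ S, m p := by
    rw [hT, mul_sum, ← smul_eq_mul, ← sum_const]
    exact sum_le_sum hZ
  have hXpos : 0 < 2 ^ (n * k) := by positivity
  have hK : 0 < 2 ^ k := by positivity
  have hE : 256 ≤ 2 ^ D := by simpa using Nat.pow_le_pow_right (n := 2) (by norm_num) hD
  rw [pow_add]
  generalize 2 ^ (n * k) = X at *
  generalize 2 ^ k = Y at *
  generalize 2 ^ D = E at *
  generalize ∑ p ∈ S, m p = T at *
  generalize ∑ p ∈ S, m p ^ 2 = Q at *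
  generalize #S = s at *
  generalize #Z = N at *
  rcases Nat.eq_zero_or_pos N with rfl | hN
  · simp
  have step : (N * X ^ 2) * (N * E) ≤ (N * X ^ 2) * (100 * (Y + N)) := calc
    (N * X ^ 2) * (N * E) = (N * X) ^ 2 * E := by ring
    _ ≤ (10 * T) ^ 2 * E := by gcongr
    _ = 100 * T ^ 2 * E := by ring
    _ ≤ 100 * (s * Q) * E := by gcongr
    _ = 100 * (s * E) * Q := by ring
    _ ≤ 100 * (X * Y) * Q := by gcongr
    _ = 100 * X * (Q * Y) := by ring
    _ ≤ 100 * X * (X * (N * Y + N ^ 2)) := by gcongr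
    _ = _ := by ring
  have := Nat.le_of_mul_le_mul_left step (by positivity)
  nlinarith [Nat.mul_le_mul_left N hE]

theorem condC_lt_iff {V : List Bool × List Bool →. List Bool} {x y : List Bool} {m : ℕ} :
    condC V x y < m ↔ ∃ d : List Bool, x ∈ V (d, y) ∧ d.length < m := by
  simp only [condC, sInf_lt_iff, Set.mem_ofPred_eq]
  constructor
  · rintro ⟨_, ⟨d, hd, rfl⟩, h⟩
    exact ⟨d, hd, by exact_mod_cast h⟩
  · rintro ⟨d, hd, h⟩
    exact ⟨_, ⟨d, hd, rfl⟩, by exact_mod_cast h⟩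

theorem condC_le {V : List Bool × List Bool →. List Bool} {x y d : List Bool}
    (h : x ∈ V (d, y)) : condC V x y ≤ d.length :=
  sInf_le ⟨d, h, rfl⟩

/-- Fewer than `2 ^ m` strings have complexity below `m`. -/
theorem card_condC_lt {β : Type*} {V : List Bool × List Bool →. List Bool} {y : List Bool} {m : ℕ}
    {f : β → List Bool} (hf : Function.Injective f) {S : Finset β}
    (hS : ∀ b ∈ S, condC V (f b) y < m) : S.card < 2 ^ m := by
  classical
  simp only [condC_lt_iff] at hS
  choose! d hd hlen using hS
  let T : Finset (List Bool) :=
    (Finset.univ : Finset (Σ i : Fin m, List.Vector Bool i)).image fun v => v.2.toList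
  have hT : T.card < 2 ^ m := by
    refine Finset.card_image_le.trans_lt ?_
    rw [Finset.card_univ, Fintype.card_sigma]
    simp only [card_vector, Fintype.card_bool]
    rw [Fin.sum_univ_eq_sum_range (fun i => 2 ^ i)]
    exact Nat.geomSum_lt le_rfl (fun i hi => Finset.mem_range.1 hi)
  refine (Finset.card_le_card_of_injOn d ?_ ?_).trans_lt hT
  · intro b hb
    exact Finset.mem_coe.2 (Finset.mem_image.2
      ⟨⟨⟨_, hlen b hb⟩, ⟨d b, rfl⟩⟩, Finset.mem_univ _, rfl⟩)
  · intro b hb b' hb' e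
    have h := hd b hb
    rw [e] at h
    exact hf (Part.mem_unique h (hd b' hb'))

/-- The rows of a binary matrix, as strings. -/
def matRows {k n : ℕ} (A : Matrix (Fin k) (Fin n) (ZMod 2)) : List (List Bool) :=
  (List.finRange k).map fun i => (List.finRange n).map fun j => decide (A i j = 1)

theorem flatten_matRows {k n : ℕ} (A : Matrix (Fin k) (Fin n) (ZMod 2)) :
    (matRows A).flatten = encM A := by
  simp [matRows, encM, List.flatMap_def]

theorem length_matRows {k n : ℕ} (A : Matrix (Fin k) (Fin n) (ZMod 2)) :
    (matRows A).length = k := by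
  simp [matRows]

theorem length_of_mem_matRows {k n : ℕ} {A : Matrix (Fin k) (Fin n) (ZMod 2)} {r : List Bool}
    (hr : r ∈ matRows A) : r.length = n := by
  simp only [matRows, List.mem_map] at hr
  obtain ⟨i, -, rfl⟩ := hr
  simp

theorem zmod_two_eq_one_iff_iff {a b : ZMod 2} : (a = 1 ↔ b = 1) ↔ a = b := by
  revert a b; decide

theorem matRows_injective {k n : ℕ} :
    Function.Injective (matRows : Matrix (Fin k) (Fin n) (ZMod 2) → _) := by
  intro A B h
  ext i j
  simpa [zmod_two_eq_one_iff_iff] using List.map_inj_left.1 (List.map_inj_left.1 h i (by simp)) j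

theorem exists_matRows_eq {k n : ℕ} {L : List (List Bool)} (hk : L.length = k)
    (hn : ∀ r ∈ L, r.length = n) :
    ∃ A : Matrix (Fin k) (Fin n) (ZMod 2), matRows A = L := by
  refine ⟨Matrix.of fun i j => if (L.getD i []).getD j false then 1 else 0, ?_⟩
  refine List.ext_getElem (by simp [matRows, hk]) fun i hi hi' => ?_
  have hl := hn _ (List.getElem_mem hi')
  refine List.ext_getElem (by simp [matRows, hl]) fun j hj hj' => ?_
  simp [matRows, hi', hj']

theorem encM_append_strOf_injective {k n : ℕ} : Function.Injective
    fun p : Matrix (Fin k) (Fin n) (ZMod 2) × (Fin k → ZMod 2) => encM p.1 ++ strOf p.2 := by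
  rintro ⟨A, u⟩ ⟨B, v⟩ h
  obtain ⟨h1, h2⟩ := List.append_inj' h (by simp [strOf])
  refine Prod.ext (matRows_injective ?_) (funext fun i => ?_)
  · rw [List.eq_iff_flatten_eq, flatten_matRows, flatten_matRows]
    exact ⟨h1, by simp [matRows]⟩
  · simpa [zmod_two_eq_one_iff_iff] using congrFun (List.ofFn_injective h2) i

/-- The inner product modulo 2 of the first `n` bits of two strings. -/
def dotBit (n : ℕ) (r z : List Bool) : Bool :=
  (List.range n).foldr (fun j acc => xor (r.getD j false && z.getD j false) acc) false

theorem foldr_xor_eq_decide_sum {ι : Type*} (f : ι → Bool) (l : List ι) :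
    l.foldr (fun j acc => xor (f j) acc) false =
      decide ((l.map fun j => if f j then (1 : ZMod 2) else 0).sum = 1) := by
  have key : ∀ (b : Bool) (s : ZMod 2),
      xor b (decide (s = 1)) = decide ((if b then 1 else 0) + s = 1) := by decide
  induction l with
  | nil => rfl
  | cons j l ih => rw [List.foldr_cons, ih, List.map_cons, List.sum_cons, key]

theorem map_dotBit_matRows {k n : ℕ} (A : Matrix (Fin k) (Fin n) (ZMod 2)) (z : List Bool) :
    (matRows A).map (fun r => dotBit n r z) = strOf (A.mulVec (vecOf n z)) := by
  have key : ∀ (a : ZMod 2) (b : Bool),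
      (if (decide (a = 1) && b) then (1 : ZMod 2) else 0) = a * if b then 1 else 0 := by decide
  rw [matRows, strOf, List.map_map, List.ofFn_eq_map]
  refine List.map_congr_left fun i _ => ?_
  simp only [Function.comp_apply, dotBit]
  rw [foldr_xor_eq_decide_sum, ← List.map_coe_finRange_eq_range, List.map_map, Matrix.mulVec,
    dotProduct, Fin.sum_univ_def]
  congr 4
  funext j
  simp only [Function.comp_apply, vecOf]
  rw [← key]
  simp

/-- The number encoded by a string, least significant bit first. -/
def bitsVal (s : List Bool) : ℕ :=
  s.foldr (fun b a => b.toNat + 2 * a) 0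

theorem bitsVal_bits (n : ℕ) : bitsVal n.bits = n := by
  induction n using Nat.binaryRec' with
  | zero => rfl
  | bit b n h ih =>
    rw [Nat.bits_append_bit n b h, bitsVal, List.foldr_cons]
    change b.toNat + 2 * bitsVal n.bits = _
    rw [ih, Nat.bit_val, add_comm]

theorem bitsVal_append (s t : List Bool) :
    bitsVal (s ++ t) = bitsVal s + 2 ^ s.length * bitsVal t := by
  induction s with
  | nil => simp [bitsVal]
  | cons b s ih =>
    change b.toNat + 2 * bitsVal (s ++ t) = (b.toNat + 2 * bitsVal s) + _
    rw [ih, List.length_cons]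
    ring

theorem exists_bitsVal_eq {l i : ℕ} (h : i < 2 ^ l) :
    ∃ s : List Bool, s.length = l ∧ bitsVal s = i := by
  induction l generalizing i with
  | zero => exact ⟨[], rfl, by simp at h; simp [bitsVal, h]⟩
  | succ l ih =>
    obtain ⟨s, hs, hv⟩ := ih (i := i / 2) (by omega)
    refine ⟨i.bodd :: s, by simp [hs], ?_⟩
    change i.bodd.toNat + 2 * bitsVal s = i
    rw [hv, ← Nat.div2_val]
    exact Nat.bodd_add_div2 i

theorem primrec_dotBit :
    Primrec fun p : ℕ × List Bool × List Bool => dotBit p.1 p.2.1 p.2.2 := by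
  have hr : Primrec fun q : (ℕ × List Bool × List Bool) × ℕ × Bool => q.1.2.1 :=
    Primrec.fst.comp (Primrec.snd.comp Primrec.fst)
  have hz : Primrec fun q : (ℕ × List Bool × List Bool) × ℕ × Bool => q.1.2.2 :=
    Primrec.snd.comp (Primrec.snd.comp Primrec.fst)
  have hj : Primrec fun q : (ℕ × List Bool × List Bool) × ℕ × Bool => q.2.1 :=
    Primrec.fst.comp Primrec.snd
  have hacc : Primrec fun q : (ℕ × List Bool × List Bool) × ℕ × Bool => q.2.2 :=
    Primrec.snd.comp Primrec.snd
  refine Primrec.list_foldr (Primrec.list_range.comp Primrec.fst) (Primrec.const false)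
    (h := fun (p : ℕ × List Bool × List Bool) (q : ℕ × Bool) =>
      xor (p.2.1.getD q.1 false && p.2.2.getD q.1 false) q.2) ?_
  exact (Primrec.dom_finite (fun b : Bool × Bool => xor b.1 b.2)).comp
    (Primrec.pair (Primrec.and.comp ((Primrec.list_getD false).comp hr hj)
      ((Primrec.list_getD false).comp hz hj)) hacc)

theorem primrec_bitsVal : Primrec bitsVal := by
  refine Primrec.list_foldr (f := id) (h := fun _ (q : Bool × ℕ) => q.1.toNat + 2 * q.2)
    Primrec.id (Primrec.const 0) ?_
  exact Primrec.nat_add.comp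
    ((Primrec.dom_finite Bool.toNat).comp (Primrec.fst.comp Primrec.snd))
    (Primrec.nat_mul.comp (Primrec.const 2) (Primrec.snd.comp Primrec.snd))

theorem primrec_two_pow : Primrec fun n : ℕ => 2 ^ n := by
  have : Primrec₂ fun a b : ℕ => a ^ b := Primrec₂.unpaired'.1 Nat.Primrec.pow
  exact this.comp (Primrec.const 2) Primrec.id

/-- The list of the positions at which the entries of `l` first occur in `l`. -/
def firstIndices {σ : Type*} [DecidableEq σ] (l : List σ) : List ℕ :=
  l.map fun x => l.idxOf x

theorem primrec_firstIndices {σ : Type*} [Primcodable σ] [DecidableEq σ] :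
    Primrec (firstIndices : List σ → List ℕ) :=
  Primrec.list_map Primrec.id (Primrec.list_idxOf.comp Primrec.snd Primrec.fst)

theorem firstIndices_eq_range_iff {σ : Type*} [DecidableEq σ] {l : List σ} :
    firstIndices l = List.range l.length ↔ l.Nodup := by
  unfold firstIndices
  constructor
  · intro h
    exact List.Nodup.of_map _ (h ▸ List.nodup_range)
  · intro h
    refine List.ext_getElem (by simp) fun i hi hi' => ?_
    simp only [List.getElem_map, List.getElem_range]
    exact h.idxOf_getElem i _

/-- Witness that, within `t` steps, `c` prints on some input of length less than
`n * k + k - D` the rows of a `k × n` matrix followed by its product with `z`; here `q` consists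
of the rows and the input, and `x = ((D, k, n), z, t)`. -/
def HashWitness (c : Nat.Partrec.Code) (q : List (List Bool) × List Bool)
    (x : (ℕ × ℕ × ℕ) × List Bool × ℕ) : Prop :=
  q.1.length = x.1.2.1 ∧ (∀ r ∈ q.1, r.length = x.1.2.2) ∧
    q.2.length < x.1.2.2 * x.1.2.1 + x.1.2.1 - x.1.1 ∧
    c.evaln x.2.2 (Encodable.encode (q.2, ([] : List Bool))) =
      some (Encodable.encode (q.1.flatten ++ q.1.map fun r => dotBit x.1.2.2 r x.2.1))

theorem primrecRel_hashWitness (c : Nat.Partrec.Code) : PrimrecRel (HashWitness c) := by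
  let X := (List (List Bool) × List Bool) × (ℕ × ℕ × ℕ) × List Bool × ℕ
  have hrows : Primrec fun p : X => p.1.1 := Primrec.fst.comp Primrec.fst
  have hd : Primrec fun p : X => p.1.2 := Primrec.snd.comp Primrec.fst
  have hpar : Primrec fun p : X => p.2.1 := Primrec.fst.comp Primrec.snd
  have hD : Primrec fun p : X => p.2.1.1 := Primrec.fst.comp hpar
  have hk : Primrec fun p : X => p.2.1.2.1 := Primrec.fst.comp (Primrec.snd.comp hpar)
  have hn : Primrec fun p : X => p.2.1.2.2 := Primrec.snd.comp (Primrec.snd.comp hpar)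
  have hzt : Primrec fun p : X => p.2.2 := Primrec.snd.comp Primrec.snd
  have hz : Primrec fun p : X => p.2.2.1 := Primrec.fst.comp hzt
  have ht : Primrec fun p : X => p.2.2.2 := Primrec.snd.comp hzt
  have hlen : PrimrecRel fun (r : List Bool) (n : ℕ) => r.length = n :=
    Primrec.eq.comp (Primrec.list_length.comp Primrec.fst) Primrec.snd
  have hev : Primrec fun p : X =>
      c.evaln p.2.2.2 (Encodable.encode (p.1.2, ([] : List Bool))) :=
    Nat.Partrec.Code.primrec_evaln.comp (Primrec.pair (Primrec.pair ht (Primrec.const c))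
      (Primrec.encode.comp (Primrec.pair hd (Primrec.const []))))
  have hdot : Primrec fun p : X => p.1.1.map fun r => dotBit p.2.1.2.2 r p.2.2.1 :=
    Primrec.list_map hrows (primrec_dotBit.comp (Primrec.pair (hn.comp Primrec.fst)
      (Primrec.pair Primrec.snd (hz.comp Primrec.fst))))
  refine PrimrecPred.and (Primrec.eq.comp (Primrec.list_length.comp hrows) hk)
    (PrimrecPred.and (hlen.forall_mem_list.comp hrows hn) (PrimrecPred.and
      (Primrec.nat_lt.comp (Primrec.list_length.comp hd)
        (Primrec.nat_sub.comp (Primrec.nat_add.comp (Primrec.nat_mul.comp hn hk) hk) hD))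
      (Primrec.eq.comp hev (Primrec.option_some.comp (Primrec.encode.comp
        (Primrec.list_append.comp (Primrec.list_flatten.comp hrows) hdot))))))

/-- Witness that the string `z = x.2.1` of length `n` has more than a tenth of the matrices `A`
with `A` followed by `A z` compressible. -/
def HeavyWitness (c : Nat.Partrec.Code) (w : List (List (List Bool) × List Bool))
    (x : (ℕ × ℕ × ℕ) × List Bool × ℕ) : Prop :=
  x.2.1.length = x.1.2.2 ∧ 2 ^ (x.1.2.2 * x.1.2.1) < 10 * w.length ∧
    firstIndices (w.map Prod.fst) = List.range (w.map Prod.fst).length ∧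
    ∀ q ∈ w, HashWitness c q x

theorem primrecRel_heavyWitness (c : Nat.Partrec.Code) : PrimrecRel (HeavyWitness c) := by
  let X := List (List (List Bool) × List Bool) × (ℕ × ℕ × ℕ) × List Bool × ℕ
  have hw : Primrec fun p : X => p.1 := Primrec.fst
  have hpar : Primrec fun p : X => p.2.1 := Primrec.fst.comp Primrec.snd
  have hk : Primrec fun p : X => p.2.1.2.1 := Primrec.fst.comp (Primrec.snd.comp hpar)
  have hn : Primrec fun p : X => p.2.1.2.2 := Primrec.snd.comp (Primrec.snd.comp hpar)
  have hz : Primrec fun p : X => p.2.2.1 := Primrec.fst.comp (Primrec.snd.comp Primrec.snd)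
  have hm : Primrec fun p : X => p.1.map Prod.fst :=
    Primrec.list_map hw (Primrec.fst.comp Primrec.snd)
  exact PrimrecPred.and (Primrec.eq.comp (Primrec.list_length.comp hz) hn)
    (PrimrecPred.and (Primrec.nat_lt.comp (primrec_two_pow.comp (Primrec.nat_mul.comp hn hk))
        (Primrec.nat_mul.comp (Primrec.const 10) (Primrec.list_length.comp hw)))
      (PrimrecPred.and
        (Primrec.eq.comp (primrec_firstIndices.comp hm)
          (Primrec.list_range.comp (Primrec.list_length.comp hm)))
        ((primrecRel_hashWitness c).forall_mem_list.comp hw Primrec.snd)))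

/-- More than a tenth of the `k × n` matrices `A` have `A` followed by `A z` compressible
by at least `D + 1` bits. -/
def Heavy (V : List Bool × List Bool →. List Bool) (D k n : ℕ) (z : List Bool) : Prop :=
  z.length = n ∧ 2 ^ (n * k) < 10 * Nat.card {A : Matrix (Fin k) (Fin n) (ZMod 2) //
    condC V (encM A ++ strOf (A.mulVec (vecOf n z))) [] < ((n * k + k - D : ℕ) : ℕ∞)}

theorem Heavy.exists_witness {V : List Bool × List Bool →. List Bool} {c : Nat.Partrec.Code}
    (hc : ∀ p x, x ∈ V p ↔ Encodable.encode x ∈ c.eval (Encodable.encode p)) {D k n : ℕ}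
    {z : List Bool} (h : Heavy V D k n z) : ∃ w t, HeavyWitness c w ((D, k, n), z, t) := by
  classical
  obtain ⟨hz, hcard⟩ := h
  rw [Nat.card_eq_fintype_card, Fintype.card_subtype] at hcard
  set T : Finset (Matrix (Fin k) (Fin n) (ZMod 2)) := Finset.univ.filter fun A =>
    condC V (encM A ++ strOf (A.mulVec (vecOf n z))) [] < ((n * k + k - D : ℕ) : ℕ∞) with hT
  have key : ∀ A ∈ T, ∃ d t, ∀ t' ≥ t, HashWitness c (matRows A, d) ((D, k, n), z, t') := by
    intro A hA
    rw [hT, Finset.mem_filter, condC_lt_iff] at hA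
    obtain ⟨-, d, hd, hlen⟩ := hA
    rw [hc, Nat.Partrec.Code.evaln_complete] at hd
    obtain ⟨t, ht⟩ := hd
    refine ⟨d, t, fun t' htt' => ⟨length_matRows A, fun r hr => length_of_mem_matRows hr, hlen, ?_⟩⟩
    dsimp only
    rw [flatten_matRows, map_dotBit_matRows]
    exact Nat.Partrec.Code.evaln_mono htt' ht
  choose! d t hdt using key
  refine ⟨T.toList.map fun A => (matRows A, d A), T.sup t, hz, by simpa using hcard, ?_, ?_⟩
  · rw [firstIndices_eq_range_iff, List.map_map]
    exact T.nodup_toList.map matRows_injective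
  · simp only [List.mem_map, Finset.mem_toList]
    rintro _ ⟨A, hA, rfl⟩
    exact hdt A hA _ (Finset.le_sup hA)

theorem HeavyWitness.heavy {V : List Bool × List Bool →. List Bool} {c : Nat.Partrec.Code}
    (hc : ∀ p x, x ∈ V p ↔ Encodable.encode x ∈ c.eval (Encodable.encode p)) {D k n : ℕ}
    {z : List Bool} {w : List (List (List Bool) × List Bool)} {t : ℕ}
    (h : HeavyWitness c w ((D, k, n), z, t)) : Heavy V D k n z := by
  classical
  obtain ⟨hz, hcard, hnd, hw⟩ := h
  rw [firstIndices_eq_range_iff] at hnd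
  refine ⟨hz, hcard.trans_le (Nat.mul_le_mul_left _ ?_)⟩
  rw [Nat.card_eq_fintype_card, Fintype.card_subtype, ← List.length_map (f := Prod.fst),
    ← List.toFinset_card_of_nodup hnd, ← Finset.card_image_of_injective _ matRows_injective]
  refine Finset.card_le_card fun L hL => ?_
  simp only [List.mem_toFinset, List.mem_map] at hL
  obtain ⟨⟨L, d⟩, hq, rfl⟩ := hL
  obtain ⟨hk, hn, hlen, hev⟩ := hw _ hq
  obtain ⟨A, rfl⟩ := exists_matRows_eq hk hn
  refine Finset.mem_image_of_mem _ (Finset.mem_filter.2 ⟨Finset.mem_univ _, condC_lt_iff.2 ?_⟩)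
  refine ⟨d, ?_, hlen⟩
  rw [hc]
  dsimp only at hev
  rw [flatten_matRows, map_dotBit_matRows] at hev
  exact Nat.Partrec.Code.evaln_sound hev

theorem Partrec.exists_code_mem_iff {α σ : Type*} [Primcodable α] [Primcodable σ] {f : α →. σ}
    (hf : Partrec f) : ∃ c : Nat.Partrec.Code,
      ∀ a x, x ∈ f a ↔ Encodable.encode x ∈ c.eval (Encodable.encode a) := by
  obtain ⟨c, hc⟩ := Nat.Partrec.Code.exists_code.1 hf
  refine ⟨c, fun a x => ?_⟩
  simp [hc]

theorem length_mul_le_of_heavy {V : List Bool × List Bool →. List Bool} {D k n : ℕ} (hD : 8 ≤ D)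
    {l : List (List Bool)} (hl : l.Nodup) (h : ∀ z ∈ l, Heavy V D k n z) :
    l.length * 2 ^ D ≤ 2 ^ (k + 8) := by
  classical
  let S : Finset (Matrix (Fin k) (Fin n) (ZMod 2) × (Fin k → ZMod 2)) :=
    Finset.univ.filter fun p => condC V (encM p.1 ++ strOf p.2) [] < ((n * k + k - D : ℕ) : ℕ∞)
  have hS : S.card < 2 ^ (n * k + k - D) :=
    card_condC_lt encM_append_strOf_injective fun p hp => (Finset.mem_filter.1 hp).2
  have hS' : S.card * 2 ^ D ≤ 2 ^ (n * k) * 2 ^ k := by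
    rw [← pow_add]
    rcases le_total D (n * k + k) with hle | hle
    · calc S.card * 2 ^ D ≤ 2 ^ (n * k + k - D) * 2 ^ D := Nat.mul_le_mul_right _ hS.le
        _ = 2 ^ (n * k + k) := by rw [← pow_add, Nat.sub_add_cancel hle]
    · rw [Nat.sub_eq_zero_of_le hle, pow_zero, Nat.lt_one_iff] at hS
      simp [hS]
  have hnd : (l.map (vecOf n)).Nodup := by
    refine hl.map_on fun z hz z' hz' e => ?_
    refine List.ext_getElem ((h z hz).1.trans (h z' hz').1.symm) fun i hi hi' => ?_
    have := congrFun e ⟨i, (h z hz).1 ▸ hi⟩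
    simp only [vecOf, List.getD_eq_getElem _ _ hi, List.getD_eq_getElem _ _ hi'] at this
    revert this
    generalize z[i] = a
    generalize z'[i] = b
    revert a b
    decide
  have := card_heavy_mul_le hD S hS' (l.map (vecOf n)).toFinset ?_
  · rwa [List.toFinset_card_of_nodup hnd, List.length_map] at this
  · intro v hv
    obtain ⟨z, hz, rfl⟩ := List.mem_map.1 (List.mem_toFinset.1 hv)
    have := (h z hz).2.le
    rw [Nat.card_eq_fintype_card, Fintype.card_subtype] at this
    simpa [S] using this

/-- Heavy strings can be uniformly computed from their index in an enumeration. -/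
theorem exists_partrec_heavy_index {V : List Bool × List Bool →. List Bool} (hV : Partrec V) :
    ∃ f : (ℕ × ℕ × ℕ) × ℕ →. List Bool, Partrec f ∧ ∀ D k n, 8 ≤ D → ∀ z, Heavy V D k n z →
      D ≤ k + 8 ∧ ∃ i < 2 ^ (k + 8 - D), z ∈ f ((D, k, n), i) := by
  classical
  obtain ⟨c, hc⟩ := hV.exists_code_mem_iff
  let Y := List Bool × ℕ × List (List (List Bool) × List Bool)
  let g : ℕ × ℕ × ℕ → ℕ → Option (List Bool) := fun a s =>
    (Encodable.decode (α := Y) s).bind fun q =>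
      if HeavyWitness c q.2.2 (a, q.1, q.2.1) then some q.1 else none
  have hg : Primrec₂ g := by
    refine Primrec.option_bind (Primrec.decode.comp Primrec.snd) ?_
    have hq : Primrec fun p : ((ℕ × ℕ × ℕ) × ℕ) × Y => p.2 := Primrec.snd
    have hz : Primrec fun p : ((ℕ × ℕ × ℕ) × ℕ) × Y => p.2.1 := Primrec.fst.comp hq
    have ht : Primrec fun p : ((ℕ × ℕ × ℕ) × ℕ) × Y => p.2.2.1 :=
      Primrec.fst.comp (Primrec.snd.comp hq)
    have hw : Primrec fun p : ((ℕ × ℕ × ℕ) × ℕ) × Y => p.2.2.2 :=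
      Primrec.snd.comp (Primrec.snd.comp hq)
    exact Primrec.ite ((primrecRel_heavyWitness c).comp hw
      (Primrec.pair (Primrec.fst.comp Primrec.fst) (Primrec.pair hz ht)))
      (Primrec.option_some.comp hz) (Primrec.const none)
  have hg_iff : ∀ D k n z, (∃ s, g (D, k, n) s = some z) ↔ Heavy V D k n z := by
    intro D k n z
    constructor
    · rintro ⟨s, hs⟩
      obtain ⟨q, -, hq⟩ := Option.bind_eq_some_iff.1 hs
      split_ifs at hq with h
      cases hq
      exact h.heavy hc
    · intro h
      obtain ⟨w, t, hw⟩ := h.exists_witness hc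
      refine ⟨Encodable.encode ((z, t, w) : Y), ?_⟩
      simp only [g, Encodable.encodek, Option.bind_some, if_pos hw]
  obtain ⟨f, hf, hfg⟩ := exists_partrec_index hg
  refine ⟨f, hf, fun D k n hD z hz => ?_⟩
  obtain ⟨s, hs⟩ := (hg_iff D k n z).2 hz
  obtain ⟨i, hi, hmem⟩ := hfg (D, k, n) (2 ^ (k + 8) / 2 ^ D)
    (fun l hl h => (Nat.le_div_iff_mul_le (by positivity)).2
      (length_mul_le_of_heavy hD hl fun z hz => (hg_iff D k n z).1 (h z hz))) z s hs
  have hDk : D ≤ k + 8 := by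
    by_contra! hlt
    rw [Nat.div_eq_of_lt (Nat.pow_lt_pow_right (by norm_num) hlt)] at hi
    omega
  rw [Nat.pow_div hDk (by norm_num)] at hi
  exact ⟨hDk, i, hi, hmem⟩

/-- Heavy strings have short conditional descriptions; the saving grows with `j`. -/
theorem exists_condC_le_of_heavy {V : List Bool × List Bool →. List Bool}
    (hV : CondUniversal V) : ∃ c : ℕ, ∀ j k n z, 4 ≤ j → Heavy V (2 * j) k n z →
      condC V z n.bits + j ≤ (k + 9 + c : ℕ) := by
  obtain ⟨f, hf, hfh⟩ := exists_partrec_heavy_index hV.1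
  let jj : List Bool → ℕ := fun d => d.reverse.idxOf false
  let ll : List Bool → ℕ := fun d => d.length - (jj d + 1)
  let W : List Bool × List Bool →. List Bool := fun p =>
    f ((2 * jj p.1, ll p.1 + 2 * jj p.1 - 8, bitsVal p.2), bitsVal p.1 % 2 ^ ll p.1)
  have hjj : Primrec jj :=
    Primrec.list_idxOf.comp (Primrec.const false) Primrec.list_reverse
  have hll : Primrec ll := Primrec.nat_sub.comp Primrec.list_length (Primrec.succ.comp hjj)
  have hW : Partrec W := by
    refine hf.comp (Primrec.to_comp ?_)
    have h2j := Primrec.nat_mul.comp (Primrec.const 2) (hjj.comp Primrec.fst)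
      (α := List Bool × List Bool)
    have hl := hll.comp Primrec.fst (α := List Bool × List Bool)
    exact Primrec.pair (Primrec.pair h2j (Primrec.pair
        (Primrec.nat_sub.comp (Primrec.nat_add.comp hl h2j) (Primrec.const 8))
        (primrec_bitsVal.comp Primrec.snd)))
      (Primrec.nat_mod.comp (primrec_bitsVal.comp Primrec.fst) (primrec_two_pow.comp hl))
  obtain ⟨c, hc⟩ := hV.2 W hW
  refine ⟨c, fun j k n z hj hz => ?_⟩
  obtain ⟨hjk, i, hi, hmem⟩ := hfh (2 * j) k n (by omega) z hz
  obtain ⟨s, hs, hsi⟩ := exists_bitsVal_eq hi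
  let d := s ++ false :: List.replicate j true
  have hdj : jj d = j := by
    have : d.reverse = List.replicate j true ++ false :: s.reverse := by simp [d]
    simp only [jj, this]
    rw [List.idxOf_append_of_notMem (by simp)]
    simp
  have hdl : ll d = k + 8 - 2 * j := by
    simp only [ll, hdj]
    simp [d, hs]
  have hdi : bitsVal d % 2 ^ ll d = i := by
    rw [hdl, bitsVal_append, hs, Nat.add_mul_mod_self_left, hsi, Nat.mod_eq_of_lt hi]
  have hzW : z ∈ W (d, n.bits) := by
    simp only [W]
    rw [hdi, hdl, hdj, bitsVal_bits,
      show k + 8 - 2 * j + 2 * j - 8 = k by omega]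
    exact hmem
  have hlen : d.length + j = k + 9 := by
    simp only [d, List.length_append, List.length_cons, List.length_replicate, hs]
    omega
  calc condC V z n.bits + j ≤ d.length + c + j := by
        gcongr; exact (hc z _).trans (by gcongr; exact condC_le hzW)
    _ = ((d.length + j + c : ℕ) : ℕ∞) := by push_cast; ring
    _ = _ := by rw [hlen]

/-- Lemma 3 (`hash`): there is a constant `D` such that for every string `y` of
length `n` with `n + 1` prime, `k = C_V(y | n) + 5 < n`, at least `9/10` of the
`k × n` binary matrices `A` satisfy `C_V(enc(A)·f) ≥ n·k + k - D` where `f = A y`. -/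
theorem hash_lemma (V : List Bool × List Bool →. List Bool) (hV : CondUniversal V) :
    ∃ D : ℕ, ∀ (n k : ℕ) (y : List Bool), y.length = n → Nat.Prime (n + 1) →
      (k : ℕ∞) = condC V y (Nat.bits n) + 5 → k < n →
      9 * 2 ^ (n * k) ≤ 10 * Nat.card {A : Matrix (Fin k) (Fin n) (ZMod 2) //
        ((n * k + k - D : ℕ) : ℕ∞) ≤
          condC V (encM A ++ strOf (A.mulVec (vecOf n y))) []} := by
  classical
  obtain ⟨c, hc⟩ := exists_condC_le_of_heavy hV
  refine ⟨2 * (c + 15), fun n k y hy _ hk _ => ?_⟩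
  by_contra! hlt
  have hheavy : Heavy V (2 * (c + 15)) k n y := by
    refine ⟨hy, ?_⟩
    rw [Nat.card_eq_fintype_card, Fintype.card_subtype] at hlt ⊢
    have := Finset.card_filter_add_card_filter_not
      (s := (Finset.univ : Finset (Matrix (Fin k) (Fin n) (ZMod 2))))
      (fun A => ((n * k + k - 2 * (c + 15) : ℕ) : ℕ∞) ≤
          condC V (encM A ++ strOf (A.mulVec (vecOf n y))) [])
    rw [Finset.card_univ, card_matrix_zmod_two] at this
    simp only [not_le] at this
    omega
  have h := hc (c + 15) k n y (by omega) hheavy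
  have hle : ((k + (c + 15) : ℕ) : ℕ∞) ≤ ((k + 9 + c + 5 : ℕ) : ℕ∞) := by
    push_cast at h ⊢
    rw [hk] at h ⊢
    calc condC V y n.bits + 5 + (c + 15) = condC V y n.bits + (c + 15) + 5 := by ring
      _ ≤ _ := by gcongr
  have := Nat.cast_le.1 hle
  omega
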